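/- For every number of prisoners n ≥ 2, the n prisoners do not have a winning strategy when there are r = 2 rooms and q = 2 states. -/

import Mathlib

namespace PrisonersGame

/-- A deterministic strategy for a prisoner: given the list of states observed
on previous visits and the state observed on the current visit, return the
state to leave the room in and whether to declare. -/
def Strategy : Type := List ℕ → ℕ → ℕ × Bool

/-- A strategy is valid for `q` states if, whenever all states observed so far
are among `0, …, q-1`, the state it leaves the room in is among `0, …, q-1`. -/
def Strategy.ValidFor (q : ℕ) (σ : Strategy) : Prop :=
  ∀ (h : List ℕ) (s : ℕ), (∀ x ∈ h, x < q) → s < q → (σ h s).1 < q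

/-- A schedule: at each time step, one prisoner is led into one room. -/
def Schedule (n r : ℕ) : Type := ℕ → Fin n × Fin r

/-- A schedule is fair if every prisoner is led into every room infinitely often. -/
def Schedule.Fair {n r : ℕ} (sched : Schedule n r) : Prop :=
  ∀ (p : Fin n) (room : Fin r), {t : ℕ | sched t = (p, room)}.Infinite

/-- The state of play just before step `t`: the current states of the rooms, and
the list of states observed so far by each prisoner. All rooms start in state `0`. -/
def run {n r : ℕ} (strat : Fin n → Strategy) (sched : Schedule n r) :
    ℕ → (Fin r → ℕ) × (Fin n → List ℕ)
  | 0 => (fun _ => 0, fun _ => [])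
  | t + 1 =>
      let prev := run strat sched t
      let p := (sched t).1
      let room := (sched t).2
      let obs := prev.1 room
      (Function.update prev.1 room (strat p (prev.2 p) obs).1,
        Function.update prev.2 p (prev.2 p ++ [obs]))

/-- The prisoner visiting at step `t` declares during that visit. -/
def declaresAt {n r : ℕ} (strat : Fin n → Strategy) (sched : Schedule n r)
    (t : ℕ) : Prop :=
  (strat (sched t).1 ((run strat sched t).2 (sched t).1)
      ((run strat sched t).1 (sched t).2)).2 = true

/-- Every prisoner has visited every room by step `t` (inclusive). -/
def allVisitedBy {n r : ℕ} (sched : Schedule n r) (t : ℕ) : Prop :=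
  ∀ (p : Fin n) (room : Fin r), ∃ s ≤ t, sched s = (p, room)

/-- A strategy profile is winning if, for every fair schedule, some prisoner
eventually declares, and no prisoner ever declares at a time before every
prisoner has visited every room. -/
def Winning {n r : ℕ} (strat : Fin n → Strategy) : Prop :=
  ∀ sched : Schedule n r, sched.Fair →
    (∃ t, declaresAt strat sched t) ∧
    ∀ t, declaresAt strat sched t → allVisitedBy sched t

/-- `n` prisoners have a winning strategy for `r` rooms with `q` states. -/
def HasWinningStrategy (n r q : ℕ) : Prop :=
  ∃ strat : Fin n → Strategy, (∀ p, (strat p).ValidFor q) ∧ Winning (n := n) (r := r) strat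

/-- `n` prisoners have a symmetric winning strategy (all prisoners use the
same strategy) for `r` rooms with `q` states. -/
def HasSymmetricWinningStrategy (n r q : ℕ) : Prop :=
  ∃ σ : Strategy, σ.ValidFor q ∧ Winning (n := n) (r := r) (fun _ => σ)

end PrisonersGame

namespace PrisonersGame

/-- One step of play. -/
def stp {n : ℕ} (σ : Fin n → Strategy) (s : (Fin 2 → ℕ) × (Fin n → List ℕ))
    (x : Fin n × Fin 2) : (Fin 2 → ℕ) × (Fin n → List ℕ) :=
  (Function.update s.1 x.2 (σ x.1 (s.2 x.1) (s.1 x.2)).1,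
    Function.update s.2 x.1 (s.2 x.1 ++ [s.1 x.2]))

/-- The visit `x` made in state `s` comes with a declaration. -/
def decl {n : ℕ} (σ : Fin n → Strategy) (s : (Fin 2 → ℕ) × (Fin n → List ℕ))
    (x : Fin n × Fin 2) : Prop :=
  (σ x.1 (s.2 x.1) (s.1 x.2)).2 = true

/-- The state after a finite list of visits. -/
def fin {n : ℕ} (σ : Fin n → Strategy) (l : List (Fin n × Fin 2)) :
    (Fin 2 → ℕ) × (Fin n → List ℕ) :=
  l.foldl (stp σ) (fun _ => 0, fun _ => [])

theorem fin_snoc {n : ℕ} (σ : Fin n → Strategy) (l : List (Fin n × Fin 2)) (x) :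
    fin σ (l ++ [x]) = stp σ (fin σ l) x := by
  simp [fin]

theorem run_eq {n : ℕ} (σ : Fin n → Strategy) (sched : ℕ → Fin n × Fin 2) (t : ℕ) :
    run σ sched t = fin σ ((List.range t).map sched) := by
  induction t with
  | zero => rfl
  | succ t ih =>
    rw [List.range_succ, List.map_append, List.map_singleton, fin_snoc, ← ih]
    rfl

theorem declaresAt_iff {n : ℕ} (σ : Fin n → Strategy) (sched : ℕ → Fin n × Fin 2) (t : ℕ) :
    declaresAt σ sched t ↔ decl σ (fin σ ((List.range t).map sched)) (sched t) := by
  rw [← run_eq]; rfl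

/-- A list followed by a sequence. -/
def ext {n : ℕ} (L : List (Fin n × Fin 2)) (d : ℕ → Fin n × Fin 2) : ℕ → Fin n × Fin 2 :=
  fun t => L.getD t (d (t - L.length))

theorem ext_map {n : ℕ} (L : List (Fin n × Fin 2)) (d : ℕ → Fin n × Fin 2) (m : ℕ) :
    (List.range (L.length + m)).map (ext L d) = L ++ (List.range m).map d := by
  apply List.ext_getElem
  · simp
  · intro i h1 h2
    simp only [List.getElem_map, List.getElem_range, ext, List.getElem_append]
    split
    · next h => simp [List.getD, h]
    · next h => simp [List.getD, List.getElem?_eq_none (Nat.le_of_not_lt h)]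

theorem ext_map_le {n : ℕ} (L : List (Fin n × Fin 2)) (d : ℕ → Fin n × Fin 2) (t : ℕ)
    (ht : t ≤ L.length) :
    (List.range t).map (ext L d) = L.take t := by
  apply List.ext_getElem
  · simp [ht]
  · intro i h1 h2
    have : i < L.length := by simp at h1; omega
    simp [ext, List.getD, this]

theorem ext_add {n : ℕ} (L : List (Fin n × Fin 2)) (d : ℕ → Fin n × Fin 2) (m : ℕ) :
    ext L d (L.length + m) = d m := by
  simp [ext, List.getD]

theorem exists_fair (n : ℕ) (hn : 2 ≤ n) :
    ∃ d : ℕ → Fin n × Fin 2, ∀ x N, ∃ t, N ≤ t ∧ d t = x := by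
  have : Nonempty (Fin n × Fin 2) := ⟨(⟨0, by omega⟩, 0)⟩
  obtain ⟨f, hf⟩ := exists_surjective_nat (Fin n × Fin 2)
  refine ⟨fun k => f (Nat.unpair k).1, fun x N => ?_⟩
  obtain ⟨a, ha⟩ := hf x
  exact ⟨Nat.pair a N, Nat.right_le_pair a N, by simp [ha]⟩

theorem fair_of {n : ℕ} (d : ℕ → Fin n × Fin 2) (h : ∀ x N, ∃ t, N ≤ t ∧ d t = x) : Schedule.Fair d := by
  intro p r
  rw [Set.infinite_iff_exists_gt]
  intro a
  obtain ⟨t, ht, e⟩ := h (p, r) (a + 1)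
  exact ⟨t, e, by omega⟩

theorem ext_fair {n : ℕ} (L : List (Fin n × Fin 2)) (d : ℕ → Fin n × Fin 2)
    (h : ∀ x N, ∃ t, N ≤ t ∧ d t = x) : Schedule.Fair (ext L d) := by
  apply fair_of
  intro x N
  obtain ⟨t, ht, e⟩ := h x N
  exact ⟨L.length + t, by omega, by rw [ext_add, e]⟩

section
variable {n : ℕ} {σ : Fin n → Strategy}

theorem no_early (hn : 2 ≤ n) (hw : Winning (r := 2) σ)
    (o : Fin n) (l : List (Fin n × Fin 2)) (x : Fin n × Fin 2)
    (h : (o, 1) ∉ l) (hx : (o, 1) ≠ x) : ¬ decl σ (fin σ l) x := by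
  intro hd
  obtain ⟨d, hd0⟩ := exists_fair n hn
  have hF := ext_fair (l ++ [x]) d hd0
  have h1 : (List.range l.length).map (ext (l ++ [x]) d) = l := by
    rw [ext_map_le _ _ _ (by simp)]; simp
  have h2 : ext (l ++ [x]) d l.length = x := by simp [ext, List.getD]
  have h3 := (hw _ hF).2 l.length (by rw [declaresAt_iff, h1, h2]; exact hd)
  obtain ⟨t, ht, e⟩ := h3 o 1
  rcases Nat.lt_or_ge t l.length with h4 | h4
  · apply h
    rw [← h1]
    exact List.mem_map.2 ⟨t, by simpa using h4, e⟩
  · have : t = l.length := by omega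
    subst this
    exact hx (by rw [← e, h2])

/-- A monochromatic state which no visit changes. -/
def Stuck (σ : Fin n → Strategy) (s : (Fin 2 → ℕ) × (Fin n → List ℕ)) (y : ℕ) : Prop :=
  (∀ r, s.1 r = y) ∧ ∀ q m, (σ q (s.2 q ++ List.replicate m y) y).1 = y

theorem Stuck.stp {s y} (h : Stuck σ s y) (q : Fin n) (r : Fin 2) :
    stp σ s (q, r) = (s.1, Function.update s.2 q (s.2 q ++ [y])) ∧
      Stuck σ (stp σ s (q, r)) y := by
  have h0 := h.2 q 0
  simp at h0
  have e : PrisonersGame.stp σ s (q, r) = (s.1, Function.update s.2 q (s.2 q ++ [y])) := by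
    simp only [PrisonersGame.stp, h.1 r, h0]
    rw [← h.1 r, Function.update_eq_self]
  refine ⟨e, ?_⟩
  rw [e]
  refine ⟨h.1, fun p m => ?_⟩
  by_cases hp : p = q
  · subst hp
    have := h.2 p (m + 1)
    simpa [List.replicate_succ] using this
  · simpa [Function.update_of_ne hp] using h.2 p m

theorem Stuck.fold {s y} (h : Stuck σ s y) (l : List (Fin n × Fin 2)) :
    Stuck σ (l.foldl (PrisonersGame.stp σ) s) y ∧
    l.foldl (PrisonersGame.stp σ) s
      = (l.map (fun x => (x.1, (0 : Fin 2)))).foldl (PrisonersGame.stp σ) s := by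
  induction l generalizing s with
  | nil => exact ⟨h, rfl⟩
  | cons x l ih =>
    have h1 := (h.stp x.1 x.2)
    have h2 := (h.stp x.1 0)
    have := ih h1.2
    refine ⟨this.1, ?_⟩
    simp only [List.foldl_cons, List.map_cons]
    rw [h2.1, ← h1.1]
    exact this.2

theorem not_stuck (hn : 2 ≤ n) (hw : Winning (r := 2) σ)
    (o : Fin n) (l : List (Fin n × Fin 2)) (h : (o, 1) ∉ l) (y : ℕ) :
    ¬ Stuck σ (fin σ l) y := by
  intro hs
  obtain ⟨d, hd0⟩ := exists_fair n hn
  obtain ⟨t, ht⟩ := (hw _ (ext_fair l d hd0)).1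
  rw [declaresAt_iff] at ht
  rcases Nat.lt_or_ge t l.length with h4 | h4
  · rw [ext_map_le _ _ _ h4.le] at ht
    have e : ext l d t = l[t] := by simp [ext, List.getD, h4]
    refine no_early hn hw o _ _ (fun hh => h (List.mem_of_mem_take hh)) ?_ ht
    rw [e]
    intro hh
    exact h (hh ▸ List.getElem_mem h4)
  · obtain ⟨m, rfl⟩ := Nat.exists_eq_add_of_le h4
    rw [ext_map, ext_add] at ht
    have hf := hs.fold ((List.range m).map d)
    have e : fin σ (l ++ (List.range m).map d)
        = fin σ (l ++ ((List.range m).map d).map (fun x => (x.1, (0 : Fin 2)))) := by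
      simp only [fin, List.foldl_append]
      exact hf.2
    have h5 : Stuck σ (fin σ (l ++ (List.range m).map d)) y := by
      simp only [fin, List.foldl_append]
      exact hf.1
    have hd : decl σ (fin σ (l ++ (List.range m).map d)) ((d m).1, 0) := by
      unfold decl at ht ⊢
      rw [h5.1] at ht ⊢
      exact ht
    rw [e] at hd
    refine no_early hn hw o _ _ ?_ ?_ hd
    · simp only [List.mem_append, not_or]
      exact ⟨h, by simp⟩
    · simp

/-- All room states and observations are legal. -/
def Legal (s : (Fin 2 → ℕ) × (Fin n → List ℕ)) : Prop :=
  (∀ r, s.1 r < 2) ∧ ∀ p, ∀ x ∈ s.2 p, x < 2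

theorem Legal.stp (hv : ∀ p, (σ p).ValidFor 2)
    {s : (Fin 2 → ℕ) × (Fin n → List ℕ)} (h : Legal s) (x) :
    Legal (stp σ s x) := by
  constructor
  · intro r
    simp only [PrisonersGame.stp, Function.update_apply]
    split
    · exact hv _ _ _ (h.2 _) (h.1 _)
    · exact h.1 _
  · intro p y hy
    simp only [PrisonersGame.stp, Function.update_apply] at hy
    split at hy
    · rcases List.mem_append.1 hy with hy | hy
      · exact h.2 _ _ hy
      · rw [List.mem_singleton.1 hy]; exact h.1 _
    · exact h.2 _ _ hy

/-- The kind of a configuration: all rooms `y`, or rooms different. -/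
def Kind (c : Fin 2 → ℕ) : Option ℕ → Prop
  | none => c 0 ≠ c 1
  | some y => c 0 = y ∧ c 1 = y

/-- There is a run in which some prisoner other than `p` is confined to room 0, with view
`h` for `p`, ending in a configuration of kind `k`. -/
def Alt (σ : Fin n → Strategy) (p : Fin n) (h : List ℕ) (k : Option ℕ) : Prop :=
  ∃ (o : Fin n) (l : List (Fin n × Fin 2)), o ≠ p ∧ (o, 1) ∉ l ∧ Legal (fin σ l) ∧
    (fin σ l).2 p = h ∧ Kind (fin σ l).1 k

theorem Alt.legal {p : Fin n} {h k} (a : Alt σ p h k) : ∀ x ∈ h, x < 2 := by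
  obtain ⟨o, l, _, _, hl, rfl, _⟩ := a
  exact hl.2 p

theorem Alt.lt {p : Fin n} {h y} (a : Alt σ p h (some y)) : y < 2 := by
  obtain ⟨o, l, _, _, hl, rfl, hk⟩ := a
  rw [← hk.1]
  exact hl.1 0

/-- New kind after `p` flips a room from state `y`. -/
def flipKind (y : ℕ) : Option ℕ → Option ℕ
  | none => some (1 - y)
  | some _ => none

theorem two_rooms (r : Fin 2) : r = 0 ∨ r = 1 := by omega

theorem Alt.visit (hn : 2 ≤ n) (hw : Winning (r := 2) σ) (hv : ∀ p, (σ p).ValidFor 2)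
    {p : Fin n} {h k} (a : Alt σ p h k) (y : ℕ) (hy : y < 2)
    (hk : k = none ∨ k = some y) :
    (σ p h y).2 = false ∧
    ((σ p h y).1 = y → Alt σ p (h ++ [y]) k) ∧
    ((σ p h y).1 ≠ y → Alt σ p (h ++ [y]) (flipKind y k)) := by
  obtain ⟨o, l, ho, hol, hl, rfl, hK⟩ := a
  obtain ⟨r, hr⟩ : ∃ r, (fin σ l).1 r = y := by
    rcases hk with rfl | rfl
    · have h0 := hl.1 0
      have h1 := hl.1 1
      simp only [Kind] at hK
      by_cases h2 : (fin σ l).1 0 = y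
      · exact ⟨0, h2⟩
      · exact ⟨1, by omega⟩
    · exact ⟨0, hK.1⟩
  have hne : (o, (1 : Fin 2)) ≠ (p, r) := by
    intro e; exact ho (congrArg Prod.fst e)
  have hol' : (o, (1 : Fin 2)) ∉ l ++ [(p, r)] := by
    simp only [List.mem_append, List.mem_singleton, not_or]
    exact ⟨hol, hne⟩
  have hz : (σ p ((fin σ l).2 p) y).1 < 2 := hv p _ _ (hl.2 p) hy
  have hlg := hl.stp hv (p, r)
  have e1 : (stp σ (fin σ l) (p, r)).1
      = Function.update (fin σ l).1 r (σ p ((fin σ l).2 p) y).1 := by simp [stp, hr]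
  have e2 : (stp σ (fin σ l) (p, r)).2 p = (fin σ l).2 p ++ [y] := by simp [stp, hr]
  refine ⟨?_, ?_, ?_⟩
  · have := no_early hn hw o l (p, r) hol hne
    simpa [decl, hr] using this
  · intro hs
    refine ⟨o, l ++ [(p, r)], ho, hol', ?_, ?_, ?_⟩
    · rw [fin_snoc]; exact hlg
    · rw [fin_snoc]; exact e2
    · rw [fin_snoc, e1, hs, ← hr, Function.update_eq_self]; exact hK
  · intro hs
    refine ⟨o, l ++ [(p, r)], ho, hol', ?_, ?_, ?_⟩
    · rw [fin_snoc]; exact hlg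
    · rw [fin_snoc]; exact e2
    · rw [fin_snoc, e1]
      have h0 := hl.1 0
      have h1 := hl.1 1
      generalize (σ p ((fin σ l).2 p) y).1 = z at *
      rcases hk with rfl | rfl <;> rcases two_rooms r with rfl | rfl <;>
        simp [Kind, flipKind] at hK ⊢ <;> omega

/-- `p` with view `h` eventually flips when shown only `y`. -/
def Flips (σ : Fin n → Strategy) (p : Fin n) (h : List ℕ) (y : ℕ) : Prop :=
  ∃ m, (σ p (h ++ List.replicate m y) y).1 ≠ y

/-- Any prisoner confined to room 0 while the configuration is monochromatic. -/
theorem other_flips {o p q : Fin n} (hv : ∀ p, (σ p).ValidFor 2) (hop : o ≠ p) (hqp : q ≠ p)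
    (y : ℕ) (m : ℕ) : ∀ (l : List (Fin n × Fin 2)), (o, 1) ∉ l → Legal (fin σ l) →
    Kind (fin σ l).1 (some y) →
    (σ q ((fin σ l).2 q ++ List.replicate m y) y).1 ≠ y →
    Alt σ p ((fin σ l).2 p) none := by
  induction m with
  | zero =>
    intro l hol hl hK hf
    simp only [List.replicate_zero, List.append_nil] at hf
    refine ⟨o, l ++ [(q, 0)], hop, by simp [hol], ?_, ?_, ?_⟩
    · rw [fin_snoc]; exact hl.stp hv _
    · rw [fin_snoc]; simp [stp, Function.update_of_ne hqp.symm]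
    · rw [fin_snoc]; simp [stp, Kind, hK.1, hK.2, hf]
  | succ m ih =>
    intro l hol hl hK hf
    by_cases hf0 : (σ q ((fin σ l).2 q) y).1 = y
    · have e2 : (stp σ (fin σ l) (q, 0)).2 p = (fin σ l).2 p := by
        simp [stp, Function.update_of_ne hqp.symm]
      rw [← e2, ← fin_snoc]
      apply ih
      · simp [hol]
      · rw [fin_snoc]; exact hl.stp hv _
      · rw [fin_snoc]; simp [stp, Kind, hK.1, hK.2, hf0]
      · rw [fin_snoc]
        simpa [stp, hK.1, List.replicate_succ] using hf
    · refine ⟨o, l ++ [(q, 0)], hop, by simp [hol], ?_, ?_, ?_⟩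
      · rw [fin_snoc]; exact hl.stp hv _
      · rw [fin_snoc]; simp [stp, Function.update_of_ne hqp.symm]
      · rw [fin_snoc]; simp [stp, Kind, hK.1, hK.2, hf0]

theorem Alt.unlock (hn : 2 ≤ n) (hw : Winning (r := 2) σ) (hv : ∀ p, (σ p).ValidFor 2)
    {p : Fin n} {h y} (a : Alt σ p h (some y)) :
    Alt σ p h none ∨ Flips σ p h y := by
  by_contra! hc
  obtain ⟨o, l, ho, hol, hl, rfl, hK⟩ := a
  apply not_stuck hn hw o l hol y
  refine ⟨fun r => ?_, fun q m => ?_⟩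
  · rcases two_rooms r with rfl | rfl
    · exact hK.1
    · exact hK.2
  · by_contra hf
    by_cases hq : q = p
    · subst hq
      exact hc.2 ⟨m, hf⟩
    · exact hc.1 (other_flips hv ho hq y m l hol hl hK hf)

/-- Visits in `l` from `s` bring no declaration. -/
def ND (σ : Fin n → Strategy) : (Fin 2 → ℕ) × (Fin n → List ℕ) → List (Fin n × Fin 2) → Prop
  | _, [] => True
  | s, x :: l => ¬ decl σ s x ∧ ND σ (stp σ s x) l

theorem ND.append {l l' : List (Fin n × Fin 2)} : ∀ {s}, ND σ s l →
    ND σ (l.foldl (stp σ) s) l' → ND σ s (l ++ l') := by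
  induction l with
  | nil => intro s _ h; exact h
  | cons x l ih => intro s h h'; exact ⟨h.1, ih h.2 h'⟩

/-- `s'` can be reached from `s` by `l` without declaration. -/
def Path (σ : Fin n → Strategy) (s : (Fin 2 → ℕ) × (Fin n → List ℕ))
    (l : List (Fin n × Fin 2)) (s' : (Fin 2 → ℕ) × (Fin n → List ℕ)) : Prop :=
  ND σ s l ∧ l.foldl (stp σ) s = s'

theorem Path.trans {s s' s'' : (Fin 2 → ℕ) × (Fin n → List ℕ)} {l l'}
    (h : Path σ s l s') (h' : Path σ s' l' s'') : Path σ s (l ++ l') s'' := by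
  obtain ⟨h1, rfl⟩ := h
  exact ⟨h1.append h'.1, by rw [List.foldl_append]; exact h'.2⟩

/-- All prisoners have alternative explanations, of kinds `k`. -/
def AllAlt (σ : Fin n → Strategy) (s : (Fin 2 → ℕ) × (Fin n → List ℕ))
    (k : Fin n → Option ℕ) : Prop :=
  (∀ r, s.1 r < 2) ∧ ∀ p, Alt σ p (s.2 p) (k p)

theorem AllAlt.visit (hn : 2 ≤ n) (hw : Winning (r := 2) σ) (hv : ∀ p, (σ p).ValidFor 2)
    {s k} (a : AllAlt σ s k) (p : Fin n) (r : Fin 2)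
    (hk : k p = none ∨ k p = some (s.1 r)) :
    ∃ s', Path σ s [(p, r)] s' ∧ s'.2 p = s.2 p ++ [s.1 r] ∧
      (((σ p (s.2 p) (s.1 r)).1 = s.1 r ∧ s'.1 = s.1 ∧ AllAlt σ s' k) ∨
       ((σ p (s.2 p) (s.1 r)).1 ≠ s.1 r ∧ s'.1 = Function.update s.1 r (1 - s.1 r) ∧
          AllAlt σ s' (Function.update k p (flipKind (s.1 r) (k p))))) := by
  obtain ⟨v1, v2, v3⟩ := (a.2 p).visit hn hw hv (s.1 r) (a.1 r) hk
  have hz : (σ p (s.2 p) (s.1 r)).1 < 2 := hv p _ _ (a.2 p).legal (a.1 r)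
  refine ⟨stp σ s (p, r), ⟨⟨by simp [decl, v1], trivial⟩, rfl⟩, by simp [stp], ?_⟩
  by_cases hf : (σ p (s.2 p) (s.1 r)).1 = s.1 r
  · left
    have e1 : (stp σ s (p, r)).1 = s.1 := by simp [stp, hf]
    refine ⟨hf, e1, by rw [e1]; exact a.1, fun q => ?_⟩
    by_cases hq : q = p
    · subst hq
      simpa [stp] using v2 hf
    · simpa [stp, Function.update_of_ne hq] using a.2 q
  · right
    have e : (σ p (s.2 p) (s.1 r)).1 = 1 - s.1 r := by have := a.1 r; omega
    have e1 : (stp σ s (p, r)).1 = Function.update s.1 r (1 - s.1 r) := by simp [stp, e]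
    refine ⟨hf, e1, fun r' => ?_, fun q => ?_⟩
    · rw [e1, Function.update_apply]
      split
      · omega
      · exact a.1 r'
    · by_cases hq : q = p
      · subst hq
        simpa [stp] using v3 hf
      · simpa [stp, Function.update_of_ne hq] using a.2 q

theorem AllAlt.flip (hn : 2 ≤ n) (hw : Winning (r := 2) σ) (hv : ∀ p, (σ p).ValidFor 2)
    {k : Fin n → Option ℕ} (p : Fin n) (r : Fin 2) (y : ℕ)
    (hk : k p = some y) (m : ℕ) :
    ∀ s, AllAlt σ s k → s.1 r = y → (σ p (s.2 p ++ List.replicate m y) y).1 ≠ y →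
    ∃ l s', Path σ s l s' ∧ s'.1 = Function.update s.1 r (1 - y) ∧
      AllAlt σ s' (Function.update k p none) := by
  induction m with
  | zero =>
    intro s a hy hf
    obtain ⟨s', hp, _, h | h⟩ := a.visit hn hw hv p r (Or.inr (by rw [hk, hy]))
    · exact absurd h.1 (by simpa [hy] using hf)
    · refine ⟨_, s', hp, by rw [h.2.1, hy], ?_⟩
      have := h.2.2
      rwa [hk] at this
  | succ m ih =>
    intro s a hy hf
    obtain ⟨s', hp, hs, h | h⟩ := a.visit hn hw hv p r (Or.inr (by rw [hk, hy]))
    · obtain ⟨l, s'', hp', e, a'⟩ := ih s' h.2.2 (by rw [h.2.1, hy])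
        (by rw [hs, hy]; simpa [List.replicate_succ] using hf)
      exact ⟨_, s'', hp.trans hp', by rw [e, h.2.1], a'⟩
    · refine ⟨_, s', hp, by rw [h.2.1, hy], ?_⟩
      have := h.2.2
      rwa [hk] at this

theorem AllAlt.unlock (hn : 2 ≤ n) (hw : Winning (r := 2) σ) (hv : ∀ p, (σ p).ValidFor 2)
    {k : Fin n → Option ℕ} {s} (a : AllAlt σ s k) (p : Fin n) (r : Fin 2)
    (hk : k p = some (s.1 r)) :
    AllAlt σ s (Function.update k p none) ∨
    ∃ l s', Path σ s l s' ∧ s'.1 = Function.update s.1 r (1 - s.1 r) ∧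
      AllAlt σ s' (Function.update k p none) := by
  have ap := a.2 p
  rw [hk] at ap
  rcases ap.unlock hn hw hv with h | ⟨m, hm⟩
  · left
    refine ⟨a.1, fun q => ?_⟩
    by_cases hq : q = p
    · subst hq; simpa using h
    · simpa [Function.update_of_ne hq] using a.2 q
  · right
    exact AllAlt.flip hn hw hv p r (s.1 r) hk m s a rfl hm

/-- No two prisoners have alternatives of the same monochromatic kind. -/
def Inj (k : Fin n → Option ℕ) : Prop := ∀ p q y, k p = some y → k q = some y → p = q

/-- Monochromatic kinds are compatible with the actual configuration. -/
def Compat (s : (Fin 2 → ℕ) × (Fin n → List ℕ)) (k : Fin n → Option ℕ) : Prop :=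
  ∀ p y, k p = some y → s.1 0 = y ∨ s.1 1 = y

/-- The invariant. -/
def Inv (σ : Fin n → Strategy) (s : (Fin 2 → ℕ) × (Fin n → List ℕ)) : Prop :=
  ∃ k, AllAlt σ s k ∧ Inj k ∧ Compat s k

theorem Inj.none {k : Fin n → Option ℕ} (h : Inj k) (p) : Inj (Function.update k p none) := by
  intro a b y ha hb
  by_cases h1 : a = p
  · simp [h1] at ha
  by_cases h2 : b = p
  · simp [h2] at hb
  rw [Function.update_of_ne h1] at ha
  rw [Function.update_of_ne h2] at hb
  exact h a b y ha hb

theorem Compat.none {s} {k : Fin n → Option ℕ} (h : Compat s k) (p) :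
    Compat s (Function.update k p none) := by
  intro a y ha
  simp only [Function.update_apply] at ha
  split at ha
  · simp at ha
  · exact h a y ha

theorem compat_mixed {s} {k : Fin n → Option ℕ} (a : AllAlt σ s k) (h : s.1 0 ≠ s.1 1) :
    Compat s k := by
  intro p y hp
  have := a.2 p
  rw [hp] at this
  have h1 := this.lt
  have h2 := a.1 0
  have h3 := a.1 1
  omega

/-- Goal: reach the invariant again, having made visit `x`. -/
def Goal (σ : Fin n → Strategy) (s : (Fin 2 → ℕ) × (Fin n → List ℕ)) (x : Fin n × Fin 2) : Prop :=
  ∃ l s', Path σ s l s' ∧ x ∈ l ∧ Inv σ s'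

theorem Goal.of_path {s s' : (Fin 2 → ℕ) × (Fin n → List ℕ)} {l x} (h : Path σ s l s')
    (g : Goal σ s' x) : Goal σ s x := by
  obtain ⟨l', s'', h', hx, hi⟩ := g
  exact ⟨_, s'', h.trans h', List.mem_append_right _ hx, hi⟩

theorem goal_mono (hn : 2 ≤ n) (hw : Winning (r := 2) σ) (hv : ∀ p, (σ p).ValidFor 2)
    {s} (h : Inv σ s) (hm : s.1 0 = s.1 1) (p : Fin n) (r : Fin 2) :
    Goal σ s (p, r) := by
  obtain ⟨k, a, hi, hc⟩ := h
  have h01 : ∀ r r', s.1 r = s.1 r' := by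
    intro r r'
    rcases two_rooms r with rfl | rfl <;> rcases two_rooms r' with rfl | rfl <;> simp [hm]
  have hk : ∀ q, k q = none ∨ k q = some (s.1 r) := by
    intro q
    rcases hq : k q with _ | y
    · exact Or.inl rfl
    · right
      rcases hc q y hq with e | e
      · rw [← e, h01 0 r]
      · rw [← e, h01 1 r]
  obtain ⟨s', hp, _, h | h⟩ := a.visit hn hw hv p r (hk p)
  · exact ⟨_, s', hp, by simp, k, h.2.2, hi, by simpa [Compat, h.2.1] using hc⟩
  · refine ⟨_, s', hp, by simp, _, h.2.2, ?_, compat_mixed h.2.2 ?_⟩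
    · intro b c y hb hcc
      have hlt := a.1 r
      simp only [Function.update_apply] at hb hcc
      have hkb := hk b
      have hkc := hk c
      have hkp := hk p
      split at hb <;> split at hcc
      · simp_all
      · exfalso
        rcases hkp with e | e <;> rw [e] at hb <;> simp [flipKind] at hb
        rw [hcc] at hkc
        simp at hkc
        omega
      · exfalso
        rcases hkp with e | e <;> rw [e] at hcc <;> simp [flipKind] at hcc
        rw [hb] at hkb
        simp at hkb
        omega
      · exact hi b c y hb hcc
    · rw [h.2.1]
      have h0 := h01 0 r
      have h1 := h01 1 r
      rcases two_rooms r with rfl | rfl <;> simp <;> omega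

theorem goal_c (hn : 2 ≤ n) (hw : Winning (r := 2) σ) (hv : ∀ p, (σ p).ValidFor 2)
    {s} {k : Fin n → Option ℕ} (a : AllAlt σ s k) (hi : Inj k)
    (hm : s.1 0 ≠ s.1 1) (p : Fin n) (r : Fin 2) (hp : k p = none ∨ k p = some (s.1 r))
    (hq : ∀ q, q ≠ p → k q ≠ some (s.1 r)) : Goal σ s (p, r) := by
  obtain ⟨s', hP, _, h | h⟩ := a.visit hn hw hv p r hp
  · exact ⟨_, s', hP, by simp, k, h.2.2, hi, compat_mixed h.2.2 (by rw [h.2.1]; exact hm)⟩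
  · obtain ⟨_, he, a'⟩ := h
    have hlt := a.1 r
    have hall : ∀ r', s'.1 r' = 1 - s.1 r := by
      intro r'
      have h0 := a.1 0
      have h1 := a.1 1
      rw [he]
      rcases two_rooms r with rfl | rfl <;> rcases two_rooms r' with rfl | rfl <;> simp <;> omega
    have hcn : ∀ s'' : (Fin 2 → ℕ) × (Fin n → List ℕ), s''.1 = s'.1 →
        Compat s'' (Function.update k p none) := by
      intro s'' e b y hb
      simp only [Function.update_apply] at hb
      split at hb
      · simp at hb
      · next hbp =>
        have h1 := hq b hbp
        rw [hb] at h1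
        have h2 := a.2 b
        rw [hb] at h2
        have h3 := h2.lt
        left
        rw [e, hall]
        have : y ≠ s.1 r := fun e => h1 (by rw [e])
        omega
    rcases hp with e | e
    · rw [e] at a'
      simp only [flipKind] at a'
      have := a'.unlock hn hw hv p r (by simp [hall])
      rw [Function.update_idem] at this
      rcases this with h | ⟨l, s'', hP', he', a''⟩
      · exact ⟨_, s', hP, by simp, _, h, hi.none p, hcn s' rfl⟩
      · refine ⟨_, s'', hP.trans hP', by simp, _, a'', hi.none p, compat_mixed a'' ?_⟩
        rw [he']
        rcases two_rooms r with rfl | rfl <;> simp [hall] <;> omega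
    · rw [e] at a'
      exact ⟨_, s', hP, by simp, _, a', hi.none p, hcn s' rfl⟩

/-- Flipping a room in a mixed configuration whose only obstacle is `q`. -/
theorem inv_flip {s s'} {k : Fin n → Option ℕ} (a : AllAlt σ s k) (hi : Inj k)
    (hm : s.1 0 ≠ s.1 1) (q : Fin n) (r : Fin 2) (hq : k q = some (s.1 r))
    (he : s'.1 = Function.update s.1 r (1 - s.1 r))
    (a' : AllAlt σ s' (Function.update k q none)) : Inv σ s' ∧ s'.1 0 = s'.1 1 := by
  have hlt := a.1 r
  have hall : ∀ r', s'.1 r' = 1 - s.1 r := by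
    intro r'
    have h0 := a.1 0
    have h1 := a.1 1
    rw [he]
    rcases two_rooms r with rfl | rfl <;> rcases two_rooms r' with rfl | rfl <;> simp <;> omega
  refine ⟨⟨_, a', hi.none q, ?_⟩, by rw [hall, hall]⟩
  intro b y hb
  simp only [Function.update_apply] at hb
  split at hb
  · simp at hb
  · next hbq =>
    have h2 := a.2 b
    rw [hb] at h2
    have h3 := h2.lt
    left
    rw [hall]
    have : y ≠ s.1 r := fun e => hbq (hi b q y hb (by rw [hq, e]))
    omega

theorem goal_b (hn : 2 ≤ n) (hw : Winning (r := 2) σ) (hv : ∀ p, (σ p).ValidFor 2)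
    {s} {k : Fin n → Option ℕ} (a : AllAlt σ s k) (hi : Inj k)
    (hm : s.1 0 ≠ s.1 1) (p : Fin n) (r : Fin 2) (hp : k p = none ∨ k p = some (s.1 r)) :
    Goal σ s (p, r) := by
  by_cases hq : ∀ q, q ≠ p → k q ≠ some (s.1 r)
  · exact goal_c hn hw hv a hi hm p r hp hq
  · push Not at hq
    obtain ⟨q, hqp, hq⟩ := hq
    rcases a.unlock hn hw hv q r hq with h | ⟨l, s', hP, he, a'⟩
    · apply goal_c hn hw hv h (hi.none q) hm p r
      · rwa [Function.update_of_ne hqp.symm]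
      · intro b hb
        rw [Function.update_apply]
        split
        · simp
        · next hbq => exact fun e => hbq (hi b q _ e hq)
    · obtain ⟨h1, h2⟩ := inv_flip a hi hm q r hq he a'
      exact Goal.of_path hP (goal_mono hn hw hv h1 h2 p r)

theorem goal_all (hn : 2 ≤ n) (hw : Winning (r := 2) σ) (hv : ∀ p, (σ p).ValidFor 2)
    {s} (h : Inv σ s) (p : Fin n) (r : Fin 2) : Goal σ s (p, r) := by
  by_cases hm : s.1 0 = s.1 1
  · exact goal_mono hn hw hv h hm p r
  obtain ⟨k, a, hi, hc⟩ := h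
  by_cases hp : k p = none ∨ k p = some (s.1 r)
  · exact goal_b hn hw hv a hi hm p r hp
  · obtain ⟨r', hr'⟩ : ∃ r', k p = some (s.1 r') := by
      push Not at hp
      obtain ⟨y, hy⟩ := Option.ne_none_iff_exists'.1 hp.1
      rcases hc p y hy with e | e
      · exact ⟨0, by rw [hy, e]⟩
      · exact ⟨1, by rw [hy, e]⟩
    rcases a.unlock hn hw hv p r' hr' with h | ⟨l, s', hP, he, a'⟩
    · exact goal_b hn hw hv h (hi.none p) hm p r (by simp)
    · obtain ⟨h1, h2⟩ := inv_flip a hi hm p r' hr' he a'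
      exact Goal.of_path hP (goal_mono hn hw hv h1 h2 p r)

end

end PrisonersGame

namespace PrisonersGame

theorem ND.take {n : ℕ} {σ : Fin n → Strategy} {l : List (Fin n × Fin 2)} :
    ∀ {s}, ND σ s l → ∀ (t : ℕ) (ht : t < l.length),
      ¬ decl σ ((l.take t).foldl (stp σ) s) l[t] := by
  induction l with
  | nil => intro s _ t ht; simp at ht
  | cons x l ih =>
    intro s h t ht
    cases t with
    | zero => simpa using h.1
    | succ t => simpa using ih h.2 t (by simpa using ht)

theorem main {n : ℕ} (hn : 2 ≤ n) {σ : Fin n → Strategy} (hv : ∀ p, (σ p).ValidFor 2)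
    (hw : Winning (r := 2) σ) : False := by
  obtain ⟨d, hd⟩ := exists_fair n hn
  -- finite good histories
  let T := {L : List (Fin n × Fin 2) //
    ND σ (fun _ => 0, fun _ => []) L ∧ Inv σ (fin σ L)}
  have base : Inv σ (fin σ ([] : List (Fin n × Fin 2))) := by
    have hl0 : Legal (fin σ ([] : List (Fin n × Fin 2))) := by
      constructor <;> simp [fin]
    have hK : Kind (fin σ ([] : List (Fin n × Fin 2))).1 (some 0) := by simp [Kind, fin]
    have hoth : ∀ p : Fin n, ∃ o : Fin n, o ≠ p := by
      have : Nontrivial (Fin n) := Fin.nontrivial_iff_two_le.2 hn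
      exact fun p => exists_ne p
    obtain ⟨q, m, hq⟩ : ∃ q m,
        (σ q ((fin σ ([] : List (Fin n × Fin 2))).2 q ++ List.replicate m 0) 0).1 ≠ 0 := by
      by_contra! hc
      exact not_stuck hn hw ⟨0, by omega⟩ [] (by simp) 0 ⟨fun r => by simp [fin], hc⟩
    refine ⟨Function.update (fun _ => none) q (some 0), ⟨hl0.1, fun p => ?_⟩, ?_, ?_⟩
    · obtain ⟨o, ho⟩ := hoth p
      by_cases hp : p = q
      · subst hp
        rw [Function.update_self]
        exact ⟨o, [], ho, by simp, hl0, rfl, hK⟩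
      · rw [Function.update_of_ne hp]
        exact other_flips hv ho (Ne.symm hp) 0 m [] (by simp) hl0 hK hq
    · intro a b y ha hb
      by_cases h1 : a = q
      · by_cases h2 : b = q
        · rw [h1, h2]
        · simp [Function.update_of_ne h2] at hb
      · simp [Function.update_of_ne h1] at ha
    · intro a y ha
      by_cases h1 : a = q
      · subst h1
        left
        simpa [fin] using ha
      · simp [Function.update_of_ne h1] at ha
  have next : ∀ (L : T) (x : Fin n × Fin 2), ∃ L' : T, ∃ l, L'.1 = L.1 ++ l ∧ x ∈ l := by
    intro L x
    obtain ⟨l, s', hP, hx, hI⟩ := goal_all hn hw hv L.2.2 x.1 x.2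
    refine ⟨⟨L.1 ++ l, L.2.1.append hP.1, ?_⟩, l, rfl, hx⟩
    have : fin σ (L.1 ++ l) = s' := by
      rw [← hP.2]; simp [fin]
    rw [this]; exact hI
  choose f hf using next
  let S : ℕ → T := fun k => Nat.rec ⟨[], trivial, base⟩ (fun k L => f L (d k)) k
  have hS : ∀ k, ∃ l, (S (k + 1)).1 = (S k).1 ++ l ∧ d k ∈ l := fun k => hf (S k) (d k)
  have hlen : ∀ k, k ≤ (S k).1.length := by
    intro k
    induction k with
    | zero => simp
    | succ k ih =>
      obtain ⟨l, e, hm⟩ := hS k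
      have := List.length_pos_of_mem hm
      rw [e, List.length_append]; omega
  have hpre : ∀ k m, (S k).1 <+: (S (k + m)).1 := by
    intro k m
    induction m with
    | zero => exact List.prefix_rfl
    | succ m ih =>
      obtain ⟨l, e, _⟩ := hS (k + m)
      exact ih.trans (by rw [← add_assoc, e]; exact List.prefix_append _ _)
  have hpre' : ∀ k m, k ≤ m → (S k).1 <+: (S m).1 := by
    intro k m h
    obtain ⟨c, rfl⟩ := Nat.exists_eq_add_of_le h
    exact hpre k c
  have hl1 : ∀ t, t < (S (t + 1)).1.length := fun t => hlen (t + 1)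
  let sched : ℕ → Fin n × Fin 2 := fun t => (S (t + 1)).1[t]'(hl1 t)
  have hget : ∀ k t (h : t < (S k).1.length), (S k).1[t] = sched t := by
    intro k t h
    rcases le_total k (t + 1) with h' | h'
    · exact (hpre' _ _ h').getElem h
    · exact ((hpre' _ _ h').getElem (hl1 t)).symm
  have hmap : ∀ k t, t ≤ (S k).1.length → (List.range t).map sched = (S k).1.take t := by
    intro k t h
    apply List.ext_getElem
    · simp [h]
    · intro i h1 h2
      have : i < t := by simpa using h1
      simp [hget k i (by omega)]
  have hfair : Schedule.Fair sched := by
    apply fair_of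
    intro x N
    obtain ⟨k, hk, rfl⟩ := hd x N
    obtain ⟨l, e, hm⟩ := hS k
    obtain ⟨i, hi, hli⟩ := List.getElem_of_mem hm
    refine ⟨(S k).1.length + i, by have := hlen k; omega, ?_⟩
    rw [← hget (k + 1) _ (by rw [e, List.length_append]; omega), ← hli]
    simp [e]
  obtain ⟨t, ht⟩ := (hw sched hfair).1
  rw [declaresAt_iff, hmap (t + 1) t (hl1 t).le] at ht
  exact (S (t + 1)).2.1.take t (hl1 t) ht

end PrisonersGame

open PrisonersGame in
/-- For every number of prisoners `n ≥ 2`, the `n` prisoners do not have a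
winning strategy when there are `r = 2` rooms and `q = 2` states. -/
theorem no_winning_strategy_two_rooms_two_states (n : ℕ) (hn : 2 ≤ n) :
    ¬ HasWinningStrategy n 2 2 := by
  rintro ⟨σ, hv, hw⟩
  exact main hn hv hw
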